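/- arXiv:math/0204039 — 2 statements merged into one kernel-verified Lean document; each statement's English description precedes it below -/
import Mathlib

section
/- Let B be an n×n real symmetric matrix with B_{ii} = 2 for all i and B_{ij} = −2·cos(π/m_{ij}) for i ≠ j, where the m_{ij} = m_{ji} ≥ 2 are integers. For each i let s_i ∈ GL(n,ℝ) be the reflection defined on the standard basis by s_i(e_j) = e_j − B_{ij} e_i, and let c = s_1 s_2 ⋯ s_n be the Coxeter element. Then B is positive definite if and only if every complex eigenvalue of c is a root of unity different from 1. -/
open Real Polynomial

open Matrix

section CoxeterPencil

variable {n : ℕ} {R : Type*} [CommRing R]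

/-- The upper unitriangular matrix with the same strictly upper entries as `B`. -/
def upperHalf (B : Matrix (Fin n) (Fin n) R) : Matrix (Fin n) (Fin n) R :=
  Matrix.of fun i j => if i = j then 1 else if i < j then B i j else 0

/-- The pencil `t U + Uᵀ` attached to the upper half `U` of `B`. -/
def coxeterPencil (B : Matrix (Fin n) (Fin n) R) (t : R) : Matrix (Fin n) (Fin n) R :=
  t • upperHalf B + (upperHalf B)ᵀ

theorem det_upperHalf (B : Matrix (Fin n) (Fin n) R) : (upperHalf B).det = 1 := by
  rw [Matrix.det_of_isUpperTriangular]
  · simp [upperHalf]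
  · intro i j (hij : j < i)
    simp [upperHalf, hij.ne', hij.not_gt]

theorem upperHalf_map {R' : Type*} [CommRing R'] (f : R →+* R')
    (B : Matrix (Fin n) (Fin n) R) : (upperHalf B).map f = upperHalf (B.map f) := by
  ext i j
  simp [upperHalf, apply_ite f]

theorem coxeterPencil_map {R' : Type*} [CommRing R'] (f : R →+* R')
    (B : Matrix (Fin n) (Fin n) R) (t : R) :
    (coxeterPencil B t).map f = coxeterPencil (B.map f) (f t) := by
  ext i j
  simp [coxeterPencil, ← upperHalf_map]

theorem map_det_coxeterPencil {R' : Type*} [CommRing R'] (f : R →+* R')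
    (B : Matrix (Fin n) (Fin n) R) (t : R) :
    f (coxeterPencil B t).det = (coxeterPencil (B.map f) (f t)).det := by
  rw [RingHom.map_det, RingHom.mapMatrix_apply, coxeterPencil_map]

theorem upperHalf_add_transpose {B : Matrix (Fin n) (Fin n) R} (hB : B.IsSymm)
    (hdiag : ∀ i, B i i = 2) : upperHalf B + (upperHalf B)ᵀ = B := by
  ext i j
  rcases lt_trichotomy i j with h | rfl | h
  · simp [upperHalf, h.ne, h.ne', h, h.not_gt]
  · simp [upperHalf, hdiag, one_add_one_eq_two]
  · simp [upperHalf, h.ne, h.ne', h, h.not_gt, hB.apply i j]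

theorem coxeterPencil_one {B : Matrix (Fin n) (Fin n) R} (hB : B.IsSymm)
    (hdiag : ∀ i, B i i = 2) : coxeterPencil B 1 = B := by
  rw [coxeterPencil, one_smul, upperHalf_add_transpose hB hdiag]

theorem coxeterPencil_apply_self (B : Matrix (Fin n) (Fin n) R) (t : R) (i : Fin n) :
    coxeterPencil B t i i = t + 1 := by
  simp [coxeterPencil, upperHalf]

/-- The characteristic polynomial of `-U⁻¹ Uᵀ` is computed by the pencil. -/
theorem eval_charpoly_eq_det_coxeterPencil {B c : Matrix (Fin n) (Fin n) R}
    (h : upperHalf B * c = -(upperHalf B)ᵀ) (t : R) :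
    c.charpoly.eval t = (coxeterPencil B t).det := by
  have hp : coxeterPencil B t = upperHalf B * (Matrix.scalar (Fin n) t - c) := by
    rw [mul_sub, h, sub_neg_eq_add, Matrix.scalar_apply, ← Matrix.smul_one_eq_diagonal,
      Matrix.mul_smul, mul_one, coxeterPencil]
  rw [hp, Matrix.det_mul, det_upperHalf, one_mul, Matrix.eval_charpoly]

theorem reflection_list_prod_mulVec {B : Matrix (Fin n) (Fin n) R}
    {S : Fin n → Matrix (Fin n) (Fin n) R}
    (hS : ∀ i v, S i *ᵥ v = v - (B *ᵥ v) i • (Pi.single i 1 : Fin n → R))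
    (l : List (Fin n)) (hl : l.Pairwise (· < ·)) (v : Fin n → R) (i : Fin n) :
    ((l.map S).prod *ᵥ v) i = if i ∈ l then
      v i - ∑ j, B i j * (if i < j then ((l.map S).prod *ᵥ v) j else v j) else v i := by
  induction l generalizing i with
  | nil => simp
  | cons a l ih =>
    rw [List.pairwise_cons] at hl
    obtain ⟨hal, hl⟩ := hl
    specialize ih hl
    set w := (l.map S).prod *ᵥ v with hw
    have hw' : ((a :: l).map S).prod *ᵥ v = w - (B *ᵥ w) a • (Pi.single a 1 : Fin n → R) := by
      rw [List.map_cons, List.prod_cons, ← Matrix.mulVec_mulVec, hS]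
    have hne : ∀ j, j ≠ a → (((a :: l).map S).prod *ᵥ v) j = w j := by
      intro j hj
      rw [hw']
      simp [hj]
    have ha : a ∉ l := fun h => lt_irrefl _ (hal a h)
    by_cases hia : i = a
    · subst hia
      rw [if_pos List.mem_cons_self]
      have hsum : (B *ᵥ w) i =
          ∑ j, B i j * (if i < j then (((i :: l).map S).prod *ᵥ v) j else v j) := by
        rw [Matrix.mulVec, dotProduct]
        refine Finset.sum_congr rfl fun j _ => ?_
        split_ifs with hij
        · rw [hne j hij.ne']
        · rw [ih j, if_neg fun h => hij (hal j h)]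
      rw [← hsum, hw']
      simp [ih i, ha]
    · rw [hne i hia, ih i]
      simp only [List.mem_cons, hia, false_or]
      split_ifs with hil
      · congr 1
        refine Finset.sum_congr rfl fun j _ => ?_
        split_ifs with hij
        · rw [hne j ((hal i hil).trans hij).ne']
        · rfl
      · rfl

/-- The factorisation `c = -U⁻¹ Uᵀ` of a Coxeter element. -/
theorem upperHalf_mul_coxeterElement {B : Matrix (Fin n) (Fin n) R} (hB : B.IsSymm)
    (hdiag : ∀ i, B i i = 2) {S : Fin n → Matrix (Fin n) (Fin n) R}
    (hS : ∀ i v, S i *ᵥ v = v - (B *ᵥ v) i • (Pi.single i 1 : Fin n → R)) :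
    upperHalf B * ((List.finRange n).map S).prod = -(upperHalf B)ᵀ := by
  refine Matrix.ext_of_mulVec_single fun k => ?_
  generalize (Pi.single k 1 : Fin n → R) = v
  rw [← Matrix.mulVec_mulVec]
  ext i
  have key := reflection_list_prod_mulVec hS _ (List.pairwise_lt_finRange n) v i
  set w := ((List.finRange n).map S).prod *ᵥ v
  rw [if_pos (List.mem_finRange i)] at key
  have hU : (upperHalf B *ᵥ w) i = w i + ∑ j, if i < j then B i j * w j else 0 := by
    have : w i = ∑ j, if i = j then w j else 0 := by simp
    rw [this, Matrix.mulVec, dotProduct, ← Finset.sum_add_distrib]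
    refine Finset.sum_congr rfl fun j _ => ?_
    rcases lt_trichotomy i j with h | rfl | h
    · simp [upperHalf, h.ne, h]
    · simp [upperHalf]
    · simp [upperHalf, h.ne', h.not_gt]
  have hL : (-(upperHalf B)ᵀ *ᵥ v) i =
      v i - ∑ j, if i < j then 0 else B i j * v j := by
    have : v i = ∑ j, if i = j then v j else 0 := by simp
    rw [this, Matrix.mulVec, dotProduct, ← Finset.sum_sub_distrib]
    refine Finset.sum_congr rfl fun j _ => ?_
    rcases lt_trichotomy i j with h | rfl | h
    · simp [upperHalf, h.ne, h.ne', h.not_gt, h]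
    · simp [upperHalf, hdiag]; ring
    · simp [upperHalf, h.ne', h.not_gt, h, h.ne, hB.apply i j]
  rw [hU, hL, key, sub_add, ← Finset.sum_sub_distrib]
  congr 1
  refine Finset.sum_congr rfl fun j _ => ?_
  split_ifs <;> simp

section Real

variable {ι : Type*} [Fintype ι]

/-- A real matrix with nonpositive off-diagonal entries that maps some positive vector to a
positive vector is monotone. -/
theorem nonneg_of_mulVec_nonneg {A : Matrix ι ι ℝ} (hA : ∀ i j, i ≠ j → A i j ≤ 0)
    {x : ι → ℝ} (hx : ∀ i, 0 < x i) (hAx : ∀ i, 0 < (A *ᵥ x) i)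
    {y : ι → ℝ} (hy : ∀ i, 0 ≤ (A *ᵥ y) i) (k : ι) : 0 ≤ y k := by
  have : Nonempty ι := ⟨k⟩
  obtain ⟨i, hi⟩ := Finite.exists_min fun i => y i / x i
  by_contra! hk
  have hneg : y i / x i < 0 := (hi k).trans_lt (div_neg_of_neg_of_pos hk (hx k))
  set t := y i / x i with ht
  have hz : ∀ j, 0 ≤ (y - t • x) j := fun j => by
    have := (le_div_iff₀ (hx j)).mp (hi j)
    simpa using this
  have hzi : (y - t • x) i = 0 := by
    simp [ht, (hx i).ne']
  have hle : (A *ᵥ (y - t • x)) i ≤ 0 := by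
    refine Finset.sum_nonpos fun j _ => ?_
    by_cases hij : i = j
    · subst hij
      rw [hzi, mul_zero]
    · exact mul_nonpos_of_nonpos_of_nonneg (hA i j hij) (hz j)
  have hpos : 0 < (A *ᵥ (y - t • x)) i := by
    rw [Matrix.mulVec_sub, Matrix.mulVec_smul]
    simp only [Pi.sub_apply, Pi.smul_apply, smul_eq_mul]
    nlinarith [hy i, hAx i]
  exact hle.not_gt hpos

theorem posDef_of_exists_mulVec_pos {B : Matrix ι ι ℝ} (hB : B.IsSymm)
    (hoff : ∀ i j, i ≠ j → B i j ≤ 0) {x : ι → ℝ} (hx : ∀ i, 0 < x i)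
    (hBx : ∀ i, 0 < (B *ᵥ x) i) : B.PosDef := by
  refine .of_dotProduct_mulVec_pos
    (by rwa [Matrix.IsHermitian, conjTranspose_eq_transpose_of_trivial]) fun v hv => ?_
  obtain ⟨w, rfl⟩ : ∃ w : ι → ℝ, v = fun i => x i * w i :=
    ⟨fun i => v i / x i, funext fun i => by field_simp [(hx i).ne']⟩
  obtain ⟨k, hk⟩ := Function.ne_iff.mp hv
  have hk : w k ≠ 0 := fun h => hk (by simp [h])
  have hexp : star (fun i => x i * w i) ⬝ᵥ (B *ᵥ fun i => x i * w i) =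
      ∑ i, ∑ j, B i j * x i * x j * (w i * w j) := by
    simp only [dotProduct, Matrix.mulVec, Finset.mul_sum, star_trivial]
    exact Finset.sum_congr rfl fun i _ => Finset.sum_congr rfl fun j _ => by ring
  have hswap : ∑ i, ∑ j, B i j * x i * x j * w j ^ 2 = ∑ i, ∑ j, B i j * x i * x j * w i ^ 2 := by
    rw [Finset.sum_comm]
    exact Finset.sum_congr rfl fun i _ => Finset.sum_congr rfl fun j _ => by
      rw [hB.apply i j]; ring
  have hdiag : ∑ i, ∑ j, B i j * x i * x j * w i ^ 2 = ∑ i, w i ^ 2 * x i * (B *ᵥ x) i := by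
    simp only [dotProduct, Matrix.mulVec, Finset.mul_sum]
    exact Finset.sum_congr rfl fun i _ => Finset.sum_congr rfl fun j _ => by ring
  have hle : ∑ i, ∑ j, (B i j * x i * x j * w i ^ 2 + B i j * x i * x j * w j ^ 2) ≤
      ∑ i, ∑ j, 2 * (B i j * x i * x j * (w i * w j)) := by
    refine Finset.sum_le_sum fun i _ => Finset.sum_le_sum fun j _ => ?_
    by_cases hij : i = j
    · subst hij
      exact le_of_eq (by ring)
    · have : B i j * (x i * x j) * (w i - w j) ^ 2 ≤ 0 :=
        mul_nonpos_of_nonpos_of_nonneg (mul_nonpos_of_nonpos_of_nonneg (hoff i j hij)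
          (mul_pos (hx i) (hx j)).le) (sq_nonneg _)
      linarith
  have hpos : 0 < ∑ i, w i ^ 2 * x i * (B *ᵥ x) i :=
    Finset.sum_pos' (fun i _ => mul_nonneg (mul_nonneg (sq_nonneg _) (hx i).le) (hBx i).le)
      ⟨k, Finset.mem_univ k, mul_pos (mul_pos (sq_pos_of_ne_zero hk) (hx k)) (hBx k)⟩
  simp only [Finset.sum_add_distrib, ← Finset.mul_sum] at hle
  rw [hexp]
  linarith

/-- Positive definiteness passes to symmetric matrices dominated off the diagonal. -/
theorem posDef_of_abs_le {B B' : Matrix ι ι ℝ} (hpos : B.PosDef) (hB' : B'.IsSymm)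
    (hdiag : ∀ i, B' i i = B i i) (hoff : ∀ i j, i ≠ j → |B' i j| ≤ -B i j) : B'.PosDef := by
  refine .of_dotProduct_mulVec_pos
    (by rwa [Matrix.IsHermitian, conjTranspose_eq_transpose_of_trivial]) fun v hv => ?_
  have habs : (fun i => |v i|) ≠ 0 := fun h => hv (funext fun i => by
    simpa using congrFun h i)
  refine (hpos.dotProduct_mulVec_pos habs).trans_le ?_
  simp only [dotProduct, Matrix.mulVec, Finset.mul_sum, star_trivial]
  refine Finset.sum_le_sum fun i _ => Finset.sum_le_sum fun j _ => ?_
  by_cases hij : i = j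
  · subst hij
    rw [hdiag]
    exact le_of_eq (by rw [mul_left_comm, abs_mul_abs_self]; ring)
  · have h1 : |B' i j| * (|v i| * |v j|) ≤ -B i j * (|v i| * |v j|) :=
      mul_le_mul_of_nonneg_right (hoff i j hij) (by positivity)
    have h2 := neg_abs_le (v i * (B' i j * v j))
    rw [abs_mul, abs_mul] at h2
    linarith

end Real

theorem coxeterPencil_apply_nonpos {B : Matrix (Fin n) (Fin n) ℝ}
    (hoff : ∀ i j, i ≠ j → B i j ≤ 0) {t : ℝ} (ht : 0 ≤ t) {i j : Fin n} (hij : i ≠ j) :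
    coxeterPencil B t i j ≤ 0 := by
  have h := mul_nonpos_of_nonneg_of_nonpos ht (hoff i j hij)
  have h' := hoff j i hij.symm
  rcases lt_or_gt_of_ne hij with hlt | hlt
  · simpa [coxeterPencil, upperHalf, hlt.ne, hlt.ne', hlt, hlt.not_gt] using h
  · simpa [coxeterPencil, upperHalf, hlt.ne, hlt.ne', hlt, hlt.not_gt] using h'

theorem exists_upperHalf_mulVec_pos (B : Matrix (Fin n) (Fin n) ℝ) :
    ∃ x : Fin n → ℝ, (∀ i, 0 < x i) ∧ ∀ i, 0 < (upperHalf B *ᵥ x) i := by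
  set C := ∑ i, ∑ j, |B i j|
  have hC : 0 ≤ C := by positivity
  set r := (1 + C)⁻¹ with hr
  have hr0 : 0 < r := by positivity
  have hr1 : r ≤ 1 := inv_le_one_of_one_le₀ (by linarith)
  refine ⟨fun i => r ^ (i : ℕ), fun i => by positivity, fun i => ?_⟩
  have hle : ∑ j, ((if i = j then r ^ (i : ℕ) else 0) - |B i j| * r ^ ((i : ℕ) + 1)) ≤
      (upperHalf B *ᵥ fun i => r ^ (i : ℕ)) i := by
    refine Finset.sum_le_sum fun j _ => ?_
    rcases lt_trichotomy i j with h | rfl | h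
    · have h1 : |B i j| * r ^ (j : ℕ) ≤ |B i j| * r ^ ((i : ℕ) + 1) :=
        mul_le_mul_of_nonneg_left (pow_le_pow_of_le_one hr0.le hr1 h) (abs_nonneg _)
      have h2 : -|B i j| * r ^ (j : ℕ) ≤ B i j * r ^ (j : ℕ) :=
        mul_le_mul_of_nonneg_right (neg_abs_le _) (by positivity)
      simp only [upperHalf, of_apply, h.ne, h, if_true, if_false]
      linarith
    · simp only [upperHalf, of_apply, if_true]
      have : 0 ≤ |B i i| * r ^ ((i : ℕ) + 1) := by positivity
      linarith
    · have : 0 ≤ |B i j| * r ^ ((i : ℕ) + 1) := by positivity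
      simpa [upperHalf, h.ne', h.not_gt] using this
  refine lt_of_lt_of_le ?_ hle
  rw [Finset.sum_sub_distrib, ← Finset.sum_mul, Finset.sum_ite_eq, if_pos (Finset.mem_univ i)]
  have hrow : ∑ j, |B i j| ≤ C :=
    Finset.single_le_sum (f := fun i => ∑ j, |B i j|) (fun _ _ => by positivity)
      (Finset.mem_univ i)
  have hCr : C * r < 1 := by
    rw [hr, ← div_eq_mul_inv, div_lt_one (by positivity)]
    linarith
  have hlt : (∑ j, |B i j|) * r < 1 :=
    (mul_le_mul_of_nonneg_right hrow hr0.le).trans_lt hCr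
  have hri : 0 < r ^ (i : ℕ) := by positivity
  rw [pow_succ]
  nlinarith

theorem continuous_coxeterPencil (B : Matrix (Fin n) (Fin n) ℝ) :
    Continuous (coxeterPencil B) := by
  unfold coxeterPencil
  fun_prop

/-- If `B` is not positive definite then its pencil is singular at some real `t ≥ 1`. -/
theorem exists_det_coxeterPencil_eq_zero {B : Matrix (Fin n) (Fin n) ℝ} (hB : B.IsSymm)
    (hdiag : ∀ i, B i i = 2) (hoff : ∀ i j, i ≠ j → B i j ≤ 0) (hpos : ¬ B.PosDef) :
    ∃ t : ℝ, 1 ≤ t ∧ (coxeterPencil B t).det = 0 := by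
  set G : Set ℝ := {t | ∃ x : Fin n → ℝ, (∀ i, 0 < x i) ∧ ∀ i, 0 < (coxeterPencil B t *ᵥ x) i}
    with hG
  have hcont := continuous_coxeterPencil B
  have hopen : IsOpen G := by
    have : G = ⋃ x ∈ {x : Fin n → ℝ | ∀ i, 0 < x i}, ⋂ i, {t | 0 < (coxeterPencil B t *ᵥ x) i} := by
      ext t
      simp [hG]
    rw [this]
    refine isOpen_biUnion fun x _ => isOpen_iInter_of_finite fun i => ?_
    exact isOpen_lt continuous_const
      ((continuous_apply i).comp (hcont.matrix_mulVec continuous_const))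
  have hlarge : ∀ᶠ t in Filter.atTop, t ∈ G := by
    obtain ⟨x, hx, hUx⟩ := exists_upperHalf_mulVec_pos B
    have : ∀ᶠ t : ℝ in Filter.atTop, ∀ i, 0 < (coxeterPencil B t *ᵥ x) i := by
      refine Filter.eventually_all.mpr fun i => ?_
      have hlim := Filter.tendsto_atTop_add_const_right Filter.atTop (((upperHalf B)ᵀ *ᵥ x) i)
        (Filter.tendsto_id.atTop_mul_const (hUx i))
      filter_upwards [hlim.eventually_gt_atTop 0] with t ht
      simpa [coxeterPencil, Matrix.add_mulVec, Matrix.smul_mulVec] using ht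
    exact this.mono fun t ht => ⟨x, hx, ht⟩
  set Z := Gᶜ ∩ Set.Ici 1 with hZ
  have hZ1 : (1 : ℝ) ∈ Z := by
    refine ⟨?_, Set.self_mem_Ici⟩
    rintro ⟨x, hx, hPx⟩
    rw [coxeterPencil_one hB hdiag] at hPx
    exact hpos (posDef_of_exists_mulVec_pos hB hoff hx hPx)
  have hbdd : BddAbove Z := by
    obtain ⟨a, ha⟩ := Filter.eventually_atTop.mp hlarge
    exact ⟨a, fun t ht => le_of_not_ge fun h => ht.1 (ha t h)⟩
  have hmem : sSup Z ∈ Z := (hopen.isClosed_compl.inter isClosed_Ici).csSup_mem ⟨1, hZ1⟩ hbdd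
  set t₀ := sSup Z
  have ht₀ : 1 ≤ t₀ := hmem.2
  refine ⟨t₀, ht₀, ?_⟩
  by_contra hdet
  refine hmem.1 ?_
  have hinv : ContinuousAt (fun t => (coxeterPencil B t)⁻¹ *ᵥ (1 : Fin n → ℝ)) t₀ := by
    have h1 : ContinuousAt (fun t => (coxeterPencil B t)⁻¹) t₀ :=
      ContinuousAt.comp (g := Inv.inv) (continuousAt_matrix_inv _
        (by simpa using continuousAt_inv₀ hdet)) hcont.continuousAt
    exact ContinuousAt.comp (g := fun A : Matrix (Fin n) (Fin n) ℝ => A *ᵥ (1 : Fin n → ℝ))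
      (continuous_id.matrix_mulVec continuous_const).continuousAt h1
  have hsolve : ∀ t, (coxeterPencil B t).det ≠ 0 →
      coxeterPencil B t *ᵥ ((coxeterPencil B t)⁻¹ *ᵥ (1 : Fin n → ℝ)) = 1 := fun t ht => by
    rw [Matrix.mulVec_mulVec, Matrix.mul_nonsing_inv _ (isUnit_iff_ne_zero.mpr ht),
      Matrix.one_mulVec]
  have hnonneg : ∀ i, 0 ≤ ((coxeterPencil B t₀)⁻¹ *ᵥ (1 : Fin n → ℝ)) i := fun i => by
    have hev : ∀ᶠ t in nhdsWithin t₀ (Set.Ioi t₀),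
        0 ≤ ((coxeterPencil B t)⁻¹ *ᵥ (1 : Fin n → ℝ)) i := by
      have hne : ∀ᶠ t in nhdsWithin t₀ (Set.Ioi t₀), (coxeterPencil B t).det ≠ 0 :=
        (hcont.matrix_det.continuousAt.eventually_ne hdet).filter_mono nhdsWithin_le_nhds
      filter_upwards [hne, self_mem_nhdsWithin] with t ht (htgt : t₀ < t)
      have htG : t ∈ G := by
        by_contra h
        exact htgt.not_ge (le_csSup hbdd ⟨h, ht₀.trans htgt.le⟩)
      obtain ⟨x, hx, hPx⟩ := htG
      exact nonneg_of_mulVec_nonneg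
        (fun i j => coxeterPencil_apply_nonpos hoff (by linarith)) hx hPx
        (fun i => by rw [hsolve t ht]; exact zero_le_one) i
    exact ge_of_tendsto (((continuous_apply i).continuousAt.comp hinv).tendsto.mono_left
      nhdsWithin_le_nhds) hev
  have hs := hsolve t₀ hdet
  set y := (coxeterPencil B t₀)⁻¹ *ᵥ (1 : Fin n → ℝ)
  refine ⟨y, fun i => ?_, fun i => by rw [hs]; exact zero_lt_one⟩
  have hi : ∑ j, coxeterPencil B t₀ i j * y j = 1 := congrFun hs i
  have hle : ∑ j, coxeterPencil B t₀ i j * y j ≤ ∑ j, if i = j then (t₀ + 1) * y j else 0 := by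
    refine Finset.sum_le_sum fun j _ => ?_
    split_ifs with hij
    · rw [← hij, coxeterPencil_apply_self]
    · exact mul_nonpos_of_nonpos_of_nonneg
        (coxeterPencil_apply_nonpos hoff (by linarith) hij) (hnonneg j)
  rw [hi, Finset.sum_ite_eq, if_pos (Finset.mem_univ i)] at hle
  exact pos_of_mul_pos_right (zero_lt_one.trans_le hle) (by linarith)

theorem norm_eq_one_of_det_coxeterPencil_eq_zero {B : Matrix (Fin n) (Fin n) ℝ} (hpos : B.PosDef)
    (hdiag : ∀ i, B i i = 2) {μ : ℂ} (hμ : (coxeterPencil (B.map Complex.ofReal) μ).det = 0) :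
    ‖μ‖ = 1 := by
  have hsymm : B.IsSymm := by
    rw [Matrix.IsSymm, ← conjTranspose_eq_transpose_of_trivial]
    exact hpos.isHermitian
  obtain ⟨v, hv, hPv⟩ := Matrix.exists_mulVec_eq_zero_iff.mpr hμ
  set U := upperHalf (B.map Complex.ofReal) with hU
  set a := star v ⬝ᵥ (U *ᵥ v)
  set b := star v ⬝ᵥ (Uᵀ *ᵥ v)
  have hUB : U = (upperHalf B).map Complex.ofReal := (upperHalf_map Complex.ofRealHom B).symm
  have hUstar : Uᵀ = Uᴴ := by
    ext i j
    simp [hUB]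
  have hab : b = star a := by
    simp only [a, b]
    rw [hUstar, Matrix.star_dotProduct, Matrix.star_mulVec, Matrix.conjTranspose_conjTranspose,
      ← Matrix.dotProduct_mulVec]
  have hμab : μ * a + b = 0 := by
    have := congrArg (star v ⬝ᵥ ·) hPv
    simpa [coxeterPencil, Matrix.add_mulVec, Matrix.smul_mulVec, dotProduct_add] using this
  have hsum : a + b = star v ⬝ᵥ (B.map Complex.ofReal *ᵥ v) := by
    rw [← dotProduct_add, ← Matrix.add_mulVec, upperHalf_add_transpose]
    · exact hsymm.map _
    · simp [hdiag]
  have hre : (star v ⬝ᵥ (B.map Complex.ofReal *ᵥ v)).re =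
      (fun i => (v i).re) ⬝ᵥ (B *ᵥ fun i => (v i).re) +
        (fun i => (v i).im) ⬝ᵥ (B *ᵥ fun i => (v i).im) := by
    simp only [dotProduct, Matrix.mulVec, Finset.mul_sum, Complex.re_sum,
      ← Finset.sum_add_distrib]
    refine Finset.sum_congr rfl fun i _ => Finset.sum_congr rfl fun j _ => ?_
    simp
  have hne : a ≠ 0 := by
    intro ha
    rw [hab, ha, star_zero, add_zero] at hsum
    rw [← hsum, Complex.zero_re] at hre
    have hquad : ∀ x : Fin n → ℝ, 0 ≤ x ⬝ᵥ (B *ᵥ x) := fun x => by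
      simpa using hpos.posSemidef.dotProduct_mulVec_nonneg x
    have hzero : ∀ x : Fin n → ℝ, x ⬝ᵥ (B *ᵥ x) = 0 → x = 0 := fun x hx => by
      by_contra hx0
      simpa [hx] using hpos.dotProduct_mulVec_pos hx0
    have h1 := hzero _ (le_antisymm (by linarith [hquad fun i => (v i).im]) (hquad fun i => (v i).re))
    have h2 := hzero _ (le_antisymm (by linarith [hquad fun i => (v i).re]) (hquad fun i => (v i).im))
    exact hv (funext fun i => Complex.ext (congrFun h1 i) (congrFun h2 i))
  have hnorm : ‖μ‖ * ‖a‖ = ‖a‖ := by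
    rw [← norm_mul, eq_neg_of_add_eq_zero_left hμab, norm_neg, hab, norm_star]
  exact mul_eq_right₀ (norm_ne_zero_iff.mpr hne) |>.mp hnorm

/-- Every Galois conjugate of `2 cos (π / m)` is real and bounded by `2 cos (π / m)`. -/
theorem exists_real_add_inv_of_isPrimitiveRoot {m : ℕ} (hm : 2 ≤ m) {z : ℂ}
    (hz : IsPrimitiveRoot z (2 * m)) :
    ∃ r : ℝ, z + z⁻¹ = r ∧ |r| ≤ 2 * Real.cos (π / m) := by
  have hm0 : (0 : ℝ) < m := by positivity
  obtain ⟨k, hk, hcop, rfl⟩ := (Complex.isPrimitiveRoot_iff z (2 * m) (by lia)).mp hz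
  have hbound : ∀ l : ℕ, 1 ≤ l → l + 1 ≤ m → |Real.cos (π * l / m)| ≤ Real.cos (π / m) := by
    intro l hl hlm
    have hl' : (1 : ℝ) ≤ l := by exact_mod_cast hl
    have hlm' : (l : ℝ) + 1 ≤ m := by exact_mod_cast hlm
    have h1 : π / m ≤ π * l / m := by
      gcongr
      nlinarith [Real.pi_pos]
    have h2 : π * l / m ≤ π - π / m := by
      rw [← sub_nonneg]
      have : π - π / m - π * l / m = π * (m - (l + 1)) / m := by field_simp; ring
      rw [this]
      exact div_nonneg (mul_nonneg Real.pi_pos.le (by linarith)) hm0.le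
    have h0 : 0 ≤ π / m := by positivity
    rw [abs_le]
    constructor
    · rw [← Real.cos_pi_sub]
      exact Real.cos_le_cos_of_nonneg_of_le_pi (h0.trans h1) (by linarith) h2
    · exact Real.cos_le_cos_of_nonneg_of_le_pi h0 (by linarith) h1
  refine ⟨2 * Real.cos (π * k / m), ?_, ?_⟩
  · have harg : 2 * (π : ℂ) * Complex.I * ((k : ℂ) / ((2 * m : ℕ) : ℂ)) =
        ((π * k / m : ℝ) : ℂ) * Complex.I := by
      have : (m : ℂ) ≠ 0 := by exact_mod_cast hm0.ne'
      push_cast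
      field_simp
    rw [harg, ← Complex.exp_neg, ← neg_mul, Complex.ofReal_mul, Complex.ofReal_cos, Complex.cos]
    push_cast
    ring
  · rw [abs_mul, abs_two]
    refine mul_le_mul_of_nonneg_left ?_ zero_le_two
    have hk0 : k ≠ 0 := by
      rintro rfl
      rw [Nat.coprime_zero_left] at hcop
      lia
    have hkm : k ≠ m := by
      rintro rfl
      have := Nat.Coprime.eq_one_of_dvd hcop (Dvd.intro_left 2 rfl)
      lia
    rcases lt_or_gt_of_ne hkm with h | h
    · exact hbound k (by lia) (by lia)
    · have hrefl : π * k / m = 2 * π - π * ((2 * m - k : ℕ) : ℝ) / m := by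
        rw [Nat.cast_sub hk.le]
        push_cast
        field_simp
        ring
      rw [hrefl, Real.cos_two_pi_sub]
      exact hbound _ (by lia) (by lia)

theorem isIntegral_of_det_coxeterPencil_eq_zero {K : Type*} [CommRing K]
    {B : Matrix (Fin n) (Fin n) K} (hB : ∀ i j, i ≠ j → IsIntegral ℤ (B i j)) {μ : K}
    (hμ : (coxeterPencil B μ).det = 0) : IsIntegral ℤ μ := by
  let A := integralClosure ℤ K
  let B₀ : Matrix (Fin n) (Fin n) A :=
    Matrix.of fun i j => if h : i = j then 0 else ⟨B i j, hB i j h⟩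
  have hmap : upperHalf (B₀.map (algebraMap A K)) = upperHalf B := by
    ext i j
    by_cases hij : i = j
    · simp [upperHalf, hij]
    · simp [upperHalf, B₀, hij]
  let c₀ := -((upperHalf B₀)⁻¹ * (upperHalf B₀)ᵀ)
  have hc₀ : upperHalf B₀ * c₀ = -(upperHalf B₀)ᵀ := by
    rw [mul_neg, Matrix.mul_nonsing_inv_cancel_left]
    simp [det_upperHalf]
  have hc : upperHalf (B₀.map (algebraMap A K)) * c₀.map (algebraMap A K) =
      -(upperHalf (B₀.map (algebraMap A K)))ᵀ := by
    rw [← upperHalf_map, ← Matrix.map_mul, hc₀]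
    ext i j
    simp
  have hA : IsIntegral A μ := by
    refine ⟨c₀.charpoly, c₀.charpoly_monic, ?_⟩
    rw [← Polynomial.eval_map, ← Matrix.charpoly_map, eval_charpoly_eq_det_coxeterPencil hc,
      coxeterPencil, hmap]
    exact hμ
  exact isIntegral_trans (R := ℤ) (A := A) μ hA

/-- The matrix with diagonal entries `2` and off-diagonal entries `-(z i j + (z i j)⁻¹)`. -/
def rootMatrix {F : Type*} [Field F] (z : Fin n → Fin n → F) : Matrix (Fin n) (Fin n) F :=
  Matrix.of fun i j => if i = j then 2 else -(z i j + (z i j)⁻¹)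

theorem rootMatrix_map {F F' : Type*} [Field F] [Field F'] (φ : F →+* F')
    (z : Fin n → Fin n → F) : (rootMatrix z).map φ = rootMatrix fun i j => φ (z i j) := by
  ext i j
  by_cases hij : i = j
  · simp only [Matrix.map_apply, rootMatrix, of_apply, if_pos hij, map_ofNat]
  · simp only [Matrix.map_apply, rootMatrix, of_apply, if_neg hij, map_neg, map_add, map_inv₀]

theorem norm_eq_one_of_det_coxeterPencil_rootMatrix_eq_zero {m : Fin n → Fin n → ℕ}
    (hm : ∀ i j, i ≠ j → 2 ≤ m i j) {B : Matrix (Fin n) (Fin n) ℝ} (hdiag : ∀ i, B i i = 2)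
    (hoff : ∀ i j, i ≠ j → B i j = -2 * Real.cos (π / (m i j))) (hpos : B.PosDef)
    {z : Fin n → Fin n → ℂ} (hz : ∀ i j, i ≠ j → IsPrimitiveRoot (z i j) (2 * m i j))
    (hzsymm : ∀ i j, z i j = z j i) {μ : ℂ} (hμ : (coxeterPencil (rootMatrix z) μ).det = 0) :
    ‖μ‖ = 1 := by
  have hreal : ∀ i j, ∃ r : ℝ, rootMatrix z i j = r ∧ (i = j → r = 2) ∧
      (i ≠ j → |r| ≤ -B i j) := by
    intro i j
    by_cases hij : i = j
    · exact ⟨2, by simp [rootMatrix, hij], fun _ => rfl, fun h => absurd hij h⟩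
    · obtain ⟨r, hr, hle⟩ := exists_real_add_inv_of_isPrimitiveRoot (hm i j hij) (hz i j hij)
      refine ⟨-r, by rw [rootMatrix, of_apply, if_neg hij, hr, Complex.ofReal_neg],
        fun h => absurd h hij, fun _ => ?_⟩
      rw [abs_neg, hoff i j hij]
      linarith
  choose B' hB' hd ho using hreal
  have hmap : rootMatrix z = (Matrix.of B').map Complex.ofReal := by
    ext i j
    exact hB' i j
  have hsymm' : (Matrix.of B').IsSymm := by
    refine Matrix.IsSymm.ext fun i j => Complex.ofReal_injective ?_
    rw [of_apply, of_apply, ← hB', ← hB']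
    simp only [rootMatrix, of_apply, hzsymm j i, eq_comm (a := j)]
  have hpos' : (Matrix.of B').PosDef :=
    posDef_of_abs_le hpos hsymm' (fun i => by rw [of_apply, hd i i rfl, hdiag]) ho
  rw [hmap] at hμ
  exact norm_eq_one_of_det_coxeterPencil_eq_zero hpos' (fun i => hd i i rfl) hμ

theorem coxeterPencil_root_pow_eq_one {m : Fin n → Fin n → ℕ} (hsymm : ∀ i j, m i j = m j i)
    (hm : ∀ i j, i ≠ j → 2 ≤ m i j) {B : Matrix (Fin n) (Fin n) ℝ} (hdiag : ∀ i, B i i = 2)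
    (hoff : ∀ i j, i ≠ j → B i j = -2 * Real.cos (π / (m i j))) (hpos : B.PosDef) {μ : ℂ}
    (hμ : (coxeterPencil (B.map Complex.ofReal) μ).det = 0) : ∃ k : ℕ, 0 < k ∧ μ ^ k = 1 := by
  let z : Fin n → Fin n → ℂ := fun i j =>
    if i = j then 1 else Complex.exp (2 * π * Complex.I / ((2 * m i j : ℕ) : ℂ))
  have hz : ∀ i j, i ≠ j → IsPrimitiveRoot (z i j) (2 * m i j) := fun i j hij => by
    simp only [z, if_neg hij]
    exact Complex.isPrimitiveRoot_exp _ (by have := hm i j hij; lia)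
  have hzsymm : ∀ i j, z i j = z j i := fun i j => by
    simp only [z, hsymm i j, eq_comm (a := i)]
  have hB : B.map Complex.ofReal = rootMatrix z := by
    ext i j
    by_cases hij : i = j
    · simp [rootMatrix, ← hij, hdiag]
    · have hm0 : (m i j : ℂ) ≠ 0 := by
        have := hm i j hij
        exact_mod_cast (show m i j ≠ 0 by lia)
      have harg : 2 * (π : ℂ) * Complex.I / ((2 * m i j : ℕ) : ℂ) = (π / m i j : ℂ) * Complex.I := by
        push_cast
        field_simp
      rw [Matrix.map_apply, rootMatrix, of_apply, if_neg hij, hoff i j hij]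
      simp only [z, if_neg hij]
      rw [harg, ← Complex.exp_neg, ← neg_mul]
      push_cast
      rw [Complex.cos]
      ring
  rw [hB] at hμ
  have hzint : ∀ i j, IsIntegral ℤ (z i j) := fun i j => by
    by_cases hij : i = j
    · simp only [z, if_pos hij]
      exact isIntegral_one
    · exact (hz i j hij).isIntegral (by have := hm i j hij; lia)
  have hzinvint : ∀ i j, i ≠ j → IsIntegral ℤ (z i j)⁻¹ := fun i j hij =>
    (hz i j hij).inv.isIntegral (by have := hm i j hij; lia)
  have hμint : IsIntegral ℤ μ := by
    refine isIntegral_of_det_coxeterPencil_eq_zero (fun i j hij => ?_) hμ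
    rw [rootMatrix, of_apply, if_neg hij]
    exact ((hzint i j).add (hzinvint i j hij)).neg
  let s : Set ℂ := insert μ (Set.range fun p : Fin n × Fin n => z p.1 p.2)
  have hsfin : s.Finite := (Set.finite_range _).insert μ
  have : Finite s := hsfin
  let K := IntermediateField.adjoin ℚ s
  have : FiniteDimensional ℚ K := IntermediateField.finiteDimensional_adjoin fun x hx => by
    rcases hx with rfl | ⟨p, rfl⟩
    · exact hμint.tower_top
    · exact (hzint _ _).tower_top
  have : NumberField K := ⟨⟩
  let μK : K := ⟨μ, IntermediateField.subset_adjoin _ _ (Set.mem_insert _ _)⟩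
  let zK : Fin n → Fin n → K := fun i j =>
    ⟨z i j, IntermediateField.subset_adjoin _ _ (Set.mem_insert_of_mem _ ⟨(i, j), rfl⟩)⟩
  have hzK : ∀ i j, i ≠ j → IsPrimitiveRoot (zK i j) (2 * m i j) := fun i j hij =>
    IsPrimitiveRoot.of_map_of_injective (f := algebraMap K ℂ) (hz i j hij)
      (algebraMap K ℂ).injective
  have hμK : (coxeterPencil (rootMatrix zK) μK).det = 0 := by
    refine (algebraMap K ℂ).injective ?_
    rw [map_det_coxeterPencil, rootMatrix_map, map_zero]
    exact hμ
  have hμKint : IsIntegral ℤ μK :=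
    (isIntegral_algebraMap_iff (algebraMap K ℂ).injective).mp hμint
  obtain ⟨k, hk, hpow⟩ := NumberField.Embeddings.pow_eq_one_of_norm_eq_one K ℂ hμKint fun φ => by
    refine norm_eq_one_of_det_coxeterPencil_rootMatrix_eq_zero hm hdiag hoff hpos
      (z := fun i j => φ (zK i j)) (fun i j hij => (hzK i j hij).map_of_injective φ.injective)
      (fun i j => congrArg φ (Subtype.ext (hzsymm i j))) ?_
    rw [← rootMatrix_map, ← map_det_coxeterPencil, hμK, map_zero]
  exact ⟨k, hk, congrArg (algebraMap K ℂ) hpow⟩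

end CoxeterPencil

theorem spherical_iff_coxeter_element_eigenvalues_roots_of_unity
    (n : ℕ) (m : Fin n → Fin n → ℕ)
    (hsymm : ∀ i j, m i j = m j i)
    (hm : ∀ i j, i ≠ j → 2 ≤ m i j)
    (B : Matrix (Fin n) (Fin n) ℝ)
    (hBdiag : ∀ i, B i i = 2)
    (hBoff : ∀ i j, i ≠ j → B i j = -2 * Real.cos (π / (m i j)))
    (S : Fin n → Matrix (Fin n) (Fin n) ℝ)
    (hS : ∀ i j, (S i).mulVec (Pi.single j 1) =
      (Pi.single j 1 : Fin n → ℝ) - B i j • (Pi.single i 1 : Fin n → ℝ))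
    (c : Matrix (Fin n) (Fin n) ℝ)
    (hc : c = ((List.finRange n).map S).prod) :
    B.PosDef ↔
      ∀ μ : ℂ, ((c.map (Complex.ofReal)).charpoly).IsRoot μ →
        (∃ k : ℕ, 0 < k ∧ μ ^ k = 1) ∧ μ ≠ 1 := by
  have hB : B.IsSymm := Matrix.IsSymm.ext fun i j => by
    by_cases hij : i = j
    · rw [hij]
    · rw [hBoff i j hij, hBoff j i (Ne.symm hij), hsymm]
  have hle : ∀ i j, i ≠ j → B i j ≤ 0 := fun i j hij => by
    have h2 : (2 : ℝ) ≤ m i j := by exact_mod_cast hm i j hij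
    have hcos : 0 ≤ Real.cos (π / m i j) := by
      refine Real.cos_nonneg_of_mem_Icc ⟨?_, ?_⟩
      · have : 0 ≤ π / m i j := by positivity
        linarith [Real.pi_pos]
      · gcongr
    rw [hBoff i j hij]
    linarith
  have hS' : ∀ i v, S i *ᵥ v = v - (B *ᵥ v) i • (Pi.single i 1 : Fin n → ℝ) := fun i v => by
    have hSi : S i = 1 - Matrix.vecMulVec (Pi.single i 1) (B i) := by
      refine Matrix.ext_of_mulVec_single fun j => ?_
      rw [hS, Matrix.sub_mulVec, Matrix.one_mulVec, Matrix.vecMulVec_mulVec]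
      simp
    rw [hSi, Matrix.sub_mulVec, Matrix.one_mulVec, Matrix.vecMulVec_mulVec]
    simp [Matrix.mulVec]
  have hfac : upperHalf B * c = -(upperHalf B)ᵀ := by
    rw [hc]
    exact upperHalf_mul_coxeterElement hB hBdiag hS'
  have hroot : ∀ μ : ℂ, (c.map Complex.ofReal).charpoly.IsRoot μ ↔
      (coxeterPencil (B.map Complex.ofReal) μ).det = 0 := fun μ => by
    have hfac' : upperHalf (B.map Complex.ofRealHom) * c.map Complex.ofRealHom =
        -(upperHalf (B.map Complex.ofRealHom))ᵀ := by
      rw [← upperHalf_map, ← Matrix.map_mul, hfac]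
      ext i j
      simp
    exact iff_of_eq (congrArg (· = 0) (eval_charpoly_eq_det_coxeterPencil hfac' μ))
  have hdet : ∀ t : ℝ, (coxeterPencil (B.map Complex.ofReal) t).det = (coxeterPencil B t).det :=
    fun t => (map_det_coxeterPencil Complex.ofRealHom B t).symm
  simp only [hroot]
  constructor
  · refine fun hpos μ hμ =>
      ⟨coxeterPencil_root_pow_eq_one hsymm hm hBdiag hBoff hpos hμ, ?_⟩
    rintro rfl
    have h1 := hdet 1
    rw [Complex.ofReal_one, hμ, coxeterPencil_one hB hBdiag, eq_comm, Complex.ofReal_eq_zero] at h1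
    exact hpos.det_pos.ne' h1
  · intro h
    by_contra hpos
    obtain ⟨t, ht, hzero⟩ := exists_det_coxeterPencil_eq_zero hB hBdiag hle hpos
    obtain ⟨⟨k, hk, hpow⟩, hne⟩ := h t (by rw [hdet, hzero, Complex.ofReal_zero])
    have hpow' : t ^ k = 1 := by exact_mod_cast hpow
    exact hne (by rw [(pow_eq_one_iff_of_nonneg (by linarith) hk.ne').mp hpow', Complex.ofReal_one])
end

section
/- Let B be an n×n real symmetric matrix with B_{ii} = 2 for all i and B_{ij} = −2·cos(π/m_{ij}) for i ≠ j, where the m_{ij} = m_{ji} ≥ 2 are integers. For each i let s_i be the n×n matrix of the reflection s_i(e_j) = e_j − B_{ij} e_i, and let c = s_1 s_2 ⋯ s_n. Let U = I + B⁺, where B⁺ denotes the strictly upper-triangular part of B. Then U is invertible and c = −U⁻¹Uᵀ. -/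
open Real Matrix

/-- The strictly upper-triangular part of a matrix. -/
def strictUpperPart {n : ℕ} (M : Matrix (Fin n) (Fin n) ℝ) : Matrix (Fin n) (Fin n) ℝ :=
  Matrix.of fun i j => if i < j then M i j else 0

/-- Left multiplication by a reflection matrix changes only one row. -/
lemma reflection_mul_apply {n : ℕ} {B : Matrix (Fin n) (Fin n) ℝ}
    {S : Fin n → Matrix (Fin n) (Fin n) ℝ}
    (hS : ∀ i k j, S i k j = (1 : Matrix (Fin n) (Fin n) ℝ) k j - if k = i then B i j else 0)
    (P : Matrix (Fin n) (Fin n) ℝ) (i k x : Fin n) :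
    (S i * P) k x = P k x - if k = i then ∑ j, B i j * P j x else 0 := by
  simp only [Matrix.mul_apply, hS, sub_mul, Finset.sum_sub_distrib]
  rw [← Matrix.mul_apply, Matrix.one_mul]
  split_ifs <;> simp

/-- The rows of a product of reflection matrices taken in increasing order. -/
lemma prod_reflections_apply {n : ℕ} {B : Matrix (Fin n) (Fin n) ℝ}
    {S : Fin n → Matrix (Fin n) (Fin n) ℝ}
    (hS : ∀ i k j, S i k j = (1 : Matrix (Fin n) (Fin n) ℝ) k j - if k = i then B i j else 0)
    (l : List (Fin n)) (hl : l.Pairwise (· < ·)) :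
    (∀ k ∉ l, ∀ x, (l.map S).prod k x = (1 : Matrix (Fin n) (Fin n) ℝ) k x) ∧
    ∀ k ∈ l, ∀ x, (l.map S).prod k x = (1 : Matrix (Fin n) (Fin n) ℝ) k x -
      ∑ j, B k j * if k < j then (l.map S).prod j x else (1 : Matrix (Fin n) (Fin n) ℝ) j x := by
  induction l with
  | nil => simp
  | cons i l ih =>
    rw [List.pairwise_cons] at hl
    obtain ⟨hil, hl⟩ := hl
    obtain ⟨ih₁, ih₂⟩ := ih hl
    simp only [List.map_cons, List.prod_cons, reflection_mul_apply hS]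
    refine ⟨fun k hk x => ?_, fun k hk x => ?_⟩
    · rw [List.mem_cons, not_or] at hk
      rw [if_neg hk.1, sub_zero, ih₁ k hk.2]
    · rcases List.mem_cons.1 hk with rfl | hk
      · rw [if_pos rfl, ih₁ k fun h => lt_irrefl _ (hil k h)]
        congr 1
        refine Finset.sum_congr rfl fun j _ => ?_
        split_ifs with hkj hj
        · exact absurd hj hkj.ne'
        · rw [sub_zero]
        · rw [ih₁ j fun h => hkj (hil j h)]
      · have hik := hil k hk
        rw [if_neg hik.ne', sub_zero, ih₂ k hk]
        congr 1
        refine Finset.sum_congr rfl fun j _ => ?_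
        split_ifs with hkj hj
        · exact absurd hj (hik.trans hkj).ne'
        · rw [sub_zero]
        · rfl

/-- A matrix `1 + M⁺` is unipotent upper triangular, so it has determinant one. -/
lemma det_one_add_strictUpperPart {n : ℕ} (M : Matrix (Fin n) (Fin n) ℝ) :
    (1 + strictUpperPart M).det = 1 := by
  rw [Matrix.det_of_isUpperTriangular]
  · simp [strictUpperPart]
  · intro i j hij
    have hij : j < i := hij
    simp [strictUpperPart, hij.ne', hij.not_gt]

theorem coxeter_element_eq_neg_Uinv_mul_Ut
    (n : ℕ) (m : Fin n → Fin n → ℕ)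
    (hsymm : ∀ i j, m i j = m j i)
    (hm : ∀ i j, i ≠ j → 2 ≤ m i j)
    (B : Matrix (Fin n) (Fin n) ℝ)
    (hBdiag : ∀ i, B i i = 2)
    (hBoff : ∀ i j, i ≠ j → B i j = -2 * Real.cos (π / (m i j)))
    (S : Fin n → Matrix (Fin n) (Fin n) ℝ)
    (hS : ∀ i j, (S i).mulVec (Pi.single j 1) =
      (Pi.single j 1 : Fin n → ℝ) - B i j • (Pi.single i 1 : Fin n → ℝ))
    (c : Matrix (Fin n) (Fin n) ℝ)
    (hc : c = ((List.finRange n).map S).prod)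
    (U : Matrix (Fin n) (Fin n) ℝ)
    (hU : U = 1 + strictUpperPart B) :
    IsUnit U ∧ c = -(U⁻¹ * Uᵀ) := by
  have hU_det : U.det = 1 := hU ▸ det_one_add_strictUpperPart B
  have hU_unit : IsUnit U.det := hU_det ▸ isUnit_one
  have hB : ∀ i j, B i j = B j i := by
    intro i j
    rcases eq_or_ne i j with rfl | h
    · rfl
    · rw [hBoff i j h, hBoff j i h.symm, hsymm]
  have hS_apply : ∀ i k j,
      S i k j = (1 : Matrix (Fin n) (Fin n) ℝ) k j - if k = i then B i j else 0 := by
    intro i k j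
    have h := congrFun (hS i j) k
    simpa [Pi.single_apply, Matrix.one_apply] using h
  have hc_apply := (prod_reflections_apply hS_apply (List.finRange n)
    (List.pairwise_lt_finRange n)).2
  rw [← hc] at hc_apply
  have hUc : U * c = -Uᵀ := by
    ext k x
    have h_sum : ∑ j, (if k < j then B k j else 0) * c j x -
        ∑ j, B k j * (if k < j then c j x else (1 : Matrix (Fin n) (Fin n) ℝ) j x) =
        -if k < x then 0 else B k x := by
      rw [← Finset.sum_sub_distrib, Finset.sum_eq_single x]
      · split_ifs <;> simp
      · intro j _ hj
        split_ifs <;> simp [hj]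
      · simp
    have h_mul : (U * c) k x = c k x + ∑ j, (if k < j then B k j else 0) * c j x := by
      rw [hU, Matrix.add_mul, Matrix.one_mul, Matrix.add_apply, Matrix.mul_apply]
      rfl
    rw [h_mul, hc_apply k (List.mem_finRange k) x, sub_add_eq_add_sub, add_sub_assoc, h_sum, hU]
    rcases lt_trichotomy k x with h | rfl | h
    · simp [strictUpperPart, h, h.ne, h.not_gt]
    · simp [strictUpperPart, hBdiag]
      norm_num
    · simp [strictUpperPart, h, h.ne', h.not_gt, hB k x]
  refine ⟨(Matrix.isUnit_iff_isUnit_det U).2 hU_unit, ?_⟩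
  rw [← Matrix.mul_neg, ← hUc, Matrix.nonsing_inv_mul_cancel_left _ _ hU_unit]
end
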